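/- Let d ≥ 1, s > d/2, n ≥ 1 and v ∈ h^s. Then for every k ∈ ℤ^d one has (1/(2π)) ∫₀^{2π} e^{−i λ_k t} P_k(Φ_{tΛ} v, n) dt = R_k(v, n), where Φ_{tΛ} v is the sequence with entries e^{i t λ_j} v_j for j ∈ ℤ^d. -/

import Mathlib

open scoped BigOperators

/-- `lam d k = |k|²`, the squared Euclidean norm of `k ∈ ℤ^d`. -/
def lam (d : ℕ) (k : Fin d → ℤ) : ℤ := ∑ i, (k i) ^ 2

/-- The weight `|k|^{2s} + 1 = (|k|²)^s + 1` in the definition of the `h^s` norm. -/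
noncomputable def wt (d : ℕ) (s : ℝ) (k : Fin d → ℤ) : ℝ := ((lam d k : ℝ)) ^ s + 1

/-- `v ∈ h^s`, i.e. the series defining `|v|_s²` converges. -/
def memH (d : ℕ) (s : ℝ) (v : (Fin d → ℤ) → ℂ) : Prop :=
  Summable fun k => wt d s k * ‖v k‖ ^ 2

/-- The norm `|v|_s` of `h^s`. -/
noncomputable def hnorm (d : ℕ) (s : ℝ) (v : (Fin d → ℤ) → ℂ) : ℝ :=
  Real.sqrt (∑' k, wt d s k * ‖v k‖ ^ 2)

/-- The summand of `P_k(v,n)`: the monomial `v_{k₁} conj(v_{k₂}) ⋯ v_{k_{2n+1}}` if the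
tuple `κ` lies in `S(k,n)` (i.e. the alternating sum of `κ` equals `k`), and `0` otherwise. -/
noncomputable def Pterm (d n : ℕ) (v : (Fin d → ℤ) → ℂ) (k : Fin d → ℤ)
    (κ : Fin (2 * n + 1) → (Fin d → ℤ)) : ℂ :=
  if (∑ j : Fin (2 * n + 1), ((-1 : ℤ) ^ (j : ℕ)) • κ j) = k then
    ∏ j : Fin (2 * n + 1), (if Even (j : ℕ) then v (κ j) else (starRingEnd ℂ) (v (κ j)))
  else 0

/-- `P_k(v,n) = Σ_{(k₁,…,k_{2n+1}) ∈ S(k,n)} v_{k₁} conj(v_{k₂}) ⋯ v_{k_{2n+1}}`. -/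
noncomputable def Pk (d n : ℕ) (v : (Fin d → ℤ) → ℂ) (k : Fin d → ℤ) : ℂ :=
  ∑' κ : Fin (2 * n + 1) → (Fin d → ℤ), Pterm d n v k κ

/-- The summand of `R_k(v,n)`: as `Pterm`, but restricted to resonant tuples. -/
noncomputable def Rterm (d n : ℕ) (v : (Fin d → ℤ) → ℂ) (k : Fin d → ℤ)
    (κ : Fin (2 * n + 1) → (Fin d → ℤ)) : ℂ :=
  if (∑ j : Fin (2 * n + 1), ((-1 : ℤ) ^ (j : ℕ)) • κ j) = k ∧
      (∑ j : Fin (2 * n + 1), ((-1 : ℤ) ^ (j : ℕ)) * lam d (κ j)) = lam d k then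
    ∏ j : Fin (2 * n + 1), (if Even (j : ℕ) then v (κ j) else (starRingEnd ℂ) (v (κ j)))
  else 0

/-- `R_k(v,n)`, the resonant part of `P_k(v,n)`. -/
noncomputable def Rk (d n : ℕ) (v : (Fin d → ℤ) → ℂ) (k : Fin d → ℤ) : ℂ :=
  ∑' κ : Fin (2 * n + 1) → (Fin d → ℤ), Rterm d n v k κ

/-- The image of an integer vector in the standard lattice of `ℝ^d`. -/
noncomputable def intVecToLattice (d : ℕ) (k : Fin d → ℤ) :
    Submodule.span ℤ (Set.range (Pi.basisFun ℝ (Fin d))) :=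
  ⟨fun i => (k i : ℝ), (Pi.basisFun ℝ (Fin d)).mem_span_iff_repr_mem ℤ _ |>.2
    fun i => ⟨k i, by simp⟩⟩

lemma intVecToLattice_injective (d : ℕ) : Function.Injective (intVecToLattice d) := by
  intro k l h
  funext i
  have h' := congrFun (congrArg Subtype.val h) i
  exact Int.cast_injective (α := ℝ) h'

lemma norm_intVecToLattice_sq_le (d : ℕ) (k : Fin d → ℤ) :
    ‖intVecToLattice d k‖ ^ 2 ≤ (lam d k : ℝ) := by
  have h : ‖intVecToLattice d k‖ ≤ √(lam d k : ℝ) := by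
    refine (pi_norm_le_iff_of_nonneg (Real.sqrt_nonneg _)).2 fun i => ?_
    refine Real.le_sqrt_of_sq_le ?_
    have : (k i : ℤ) ^ 2 ≤ lam d k :=
      Finset.single_le_sum (f := fun i => k i ^ 2) (fun i _ => sq_nonneg _) (Finset.mem_univ i)
    change ‖((k i : ℤ) : ℝ)‖ ^ 2 ≤ (lam d k : ℝ)
    rw [Real.norm_eq_abs, sq_abs]
    exact_mod_cast this
  have h0 : (0 : ℝ) ≤ lam d k := by
    exact_mod_cast Finset.sum_nonneg fun i _ => sq_nonneg (k i)
  exact (Real.le_sqrt (norm_nonneg _) h0).1 h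

lemma wt_pos (d : ℕ) (s : ℝ) (k : Fin d → ℤ) : 0 < wt d s k := by
  have h0 : (0 : ℝ) ≤ lam d k := by
    exact_mod_cast Finset.sum_nonneg fun i _ => sq_nonneg (k i)
  have := Real.rpow_nonneg h0 s
  unfold wt
  positivity

lemma summable_inv_wt (d : ℕ) (s : ℝ) (hs : (d : ℝ) / 2 < s) :
    Summable fun k => (wt d s k)⁻¹ := by
  have hs0 : 0 < s := lt_of_le_of_lt (by positivity) hs
  have hrank : Module.finrank ℤ (Submodule.span ℤ (Set.range (Pi.basisFun ℝ (Fin d)))) = d := by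
    rw [ZLattice.rank ℝ]
    simp
  have hsum := (ZLattice.summable_norm_rpow
    (Submodule.span ℤ (Set.range (Pi.basisFun ℝ (Fin d)))) (-(2 * s))
    (by rw [hrank]; linarith)).comp_injective (intVecToLattice_injective d)
  refine Summable.of_norm_bounded_eventually hsum ?_
  refine (Set.finite_singleton (0 : Fin d → ℤ)).subset fun k hk => ?_
  by_contra hk0
  refine hk ?_
  have hne : intVecToLattice d k ≠ intVecToLattice d 0 :=
    (intVecToLattice_injective d).ne hk0
  have hzero : intVecToLattice d 0 = 0 := by
    ext i
    simp [intVecToLattice]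
  rw [hzero] at hne
  have hpos : 0 < ‖intVecToLattice d k‖ := norm_pos_iff.2 hne
  have hle : ‖intVecToLattice d k‖ ^ (2 * s) ≤ wt d s k := by
    calc ‖intVecToLattice d k‖ ^ (2 * s) = (‖intVecToLattice d k‖ ^ 2) ^ s := by
          rw [Real.rpow_mul hpos.le, Real.rpow_two]
      _ ≤ (lam d k : ℝ) ^ s :=
          Real.rpow_le_rpow (by positivity) (norm_intVecToLattice_sq_le d k) hs0.le
      _ ≤ wt d s k := by simp [wt]
  rw [Set.mem_ofPred_eq, Real.norm_of_nonneg (inv_nonneg.2 (wt_pos d s k).le),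
    Function.comp_apply]
  rw [Real.rpow_neg hpos.le]
  exact inv_anti₀ (by positivity) hle

lemma summable_norm_of_memH {d : ℕ} {s : ℝ} (hs : (d : ℝ) / 2 < s) {v : (Fin d → ℤ) → ℂ}
    (hv : memH d s v) : Summable fun k => ‖v k‖ := by
  refine Summable.of_nonneg_of_le (fun _ => norm_nonneg _) (fun k => ?_)
    ((summable_inv_wt d s hs).add hv)
  have hw := wt_pos d s k
  have h : (wt d s k)⁻¹ + wt d s k * ‖v k‖ ^ 2 - ‖v k‖
      = (wt d s k)⁻¹ * ((1 - wt d s k * ‖v k‖ / 2) ^ 2 + 3 / 4 * (wt d s k * ‖v k‖) ^ 2) := by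
    field_simp
    ring
  have : 0 ≤ (wt d s k)⁻¹ + wt d s k * ‖v k‖ ^ 2 - ‖v k‖ := by
    rw [h]
    positivity
  linarith

lemma summable_prod_fin {ι : Type*} {f : ι → ℝ} (hf : Summable f) (h0 : ∀ i, 0 ≤ f i) (m : ℕ) :
    Summable fun κ : Fin m → ι => ∏ j, f (κ j) := by
  induction m with
  | zero => exact Summable.of_finite
  | succ m ih =>
    rw [← (Fin.consEquiv fun _ : Fin (m + 1) => ι).summable_iff]
    refine (hf.mul_of_nonneg ih h0 fun κ => Finset.prod_nonneg fun j _ => h0 _).congr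
      fun p => ?_
    simp [Fin.consEquiv, Fin.prod_univ_succ]

/-- The mean of `e^{imt}` over a period is `1` if `m = 0` and `0` otherwise. -/
lemma integral_exp_int_mul_I (m : ℤ) :
    ∫ t in (0 : ℝ)..(2 * Real.pi), Complex.exp ((m : ℂ) * Complex.I * (t : ℂ))
      = if m = 0 then 2 * (Real.pi : ℂ) else 0 := by
  split_ifs with h
  · simp [h]
  · have hc : (m : ℂ) * Complex.I ≠ 0 := by simp [h]
    have h1 : (m : ℂ) * Complex.I * ((2 * Real.pi : ℝ) : ℂ)
        = m * (2 * Real.pi * Complex.I) := by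
      push_cast
      ring
    rw [integral_exp_mul_complex hc, h1, Complex.exp_int_mul_two_pi_mul_I]
    simp

lemma exp_mul_Pterm_phase (d n : ℕ) (v : (Fin d → ℤ) → ℂ) (k : Fin d → ℤ)
    (κ : Fin (2 * n + 1) → (Fin d → ℤ)) (t : ℝ) :
    Complex.exp (-Complex.I * (lam d k : ℂ) * (t : ℂ)) *
        Pterm d n (fun j => Complex.exp (Complex.I * (t : ℂ) * (lam d j : ℂ)) * v j) k κ
      = Complex.exp ((((∑ j : Fin (2 * n + 1), ((-1 : ℤ) ^ (j : ℕ)) * lam d (κ j))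
          - lam d k : ℤ) : ℂ) * Complex.I * (t : ℂ)) * Pterm d n v k κ := by
  unfold Pterm
  split_ifs with h
  · have hfac : ∀ j : Fin (2 * n + 1),
        (if Even (j : ℕ) then Complex.exp (Complex.I * (t : ℂ) * (lam d (κ j) : ℂ)) * v (κ j)
          else (starRingEnd ℂ)
            (Complex.exp (Complex.I * (t : ℂ) * (lam d (κ j) : ℂ)) * v (κ j)))
        = Complex.exp (((-1 : ℂ) ^ (j : ℕ) * lam d (κ j)) * (Complex.I * t)) *
          (if Even (j : ℕ) then v (κ j) else (starRingEnd ℂ) (v (κ j))) := by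
      intro j
      split_ifs with hj
      · rw [hj.neg_one_pow]
        ring_nf
      · rw [(Nat.not_even_iff_odd.1 hj).neg_one_pow, map_mul, ← Complex.exp_conj]
        simp only [map_mul, Complex.conj_I, Complex.conj_ofReal, map_intCast]
        ring_nf
    simp only [hfac]
    rw [Finset.prod_mul_distrib, ← Complex.exp_sum, ← mul_assoc, ← Complex.exp_add,
      ← Finset.sum_mul]
    congr 2
    push_cast
    ring
  · simp

lemma norm_Pterm_le (d n : ℕ) (v : (Fin d → ℤ) → ℂ) (k : Fin d → ℤ)
    (κ : Fin (2 * n + 1) → (Fin d → ℤ)) : ‖Pterm d n v k κ‖ ≤ ∏ j, ‖v (κ j)‖ := by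
  unfold Pterm
  split_ifs
  · rw [norm_prod]
    refine (Finset.prod_congr rfl fun j _ => ?_).le
    split_ifs <;> simp
  · simpa using Finset.prod_nonneg fun j _ => norm_nonneg (v (κ j))

/-- resonant averaging: For `d ≥ 1`, `s > d/2`, `n ≥ 1`, `v ∈ h^s` and
every `k ∈ ℤ^d`,
`(1/(2π)) ∫₀^{2π} e^{−iλ_k t} P_k(Φ_{tΛ} v, n) dt = R_k(v, n)`,
where `(Φ_{tΛ} v)_j = e^{i t λ_j} v_j`. -/
theorem resonant_averaging (d n : ℕ) (hd : 1 ≤ d) (hn : 1 ≤ n) (s : ℝ)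
    (hs : (d : ℝ) / 2 < s) (v : (Fin d → ℤ) → ℂ) (hv : memH d s v) (k : Fin d → ℤ) :
    (1 / (2 * (Real.pi : ℂ))) *
        ∫ t in (0 : ℝ)..(2 * Real.pi),
          Complex.exp (-Complex.I * (lam d k : ℂ) * (t : ℂ)) *
            Pk d n (fun j => Complex.exp (Complex.I * (t : ℂ) * (lam d j : ℂ)) * v j) k
      = Rk d n v k := by
  have hsumP : Summable fun κ : Fin (2 * n + 1) → (Fin d → ℤ) => ‖Pterm d n v k κ‖ :=
    Summable.of_nonneg_of_le (fun _ => norm_nonneg _) (norm_Pterm_le d n v k)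
      (summable_prod_fin (summable_norm_of_memH hs hv) (fun _ => norm_nonneg _) _)
  let ω (κ : Fin (2 * n + 1) → (Fin d → ℤ)) : ℤ :=
    (∑ j : Fin (2 * n + 1), ((-1 : ℤ) ^ (j : ℕ)) * lam d (κ j)) - lam d k
  let F (κ : Fin (2 * n + 1) → (Fin d → ℤ)) : C(ℝ, ℂ) :=
    ⟨fun t => Complex.exp ((ω κ : ℂ) * Complex.I * (t : ℂ)) * Pterm d n v k κ, by fun_prop⟩
  have hF : Summable fun κ => ‖(F κ).restrict
      (⟨Set.uIcc 0 (2 * Real.pi), isCompact_uIcc⟩ : TopologicalSpace.Compacts ℝ)‖ := by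
    refine Summable.of_nonneg_of_le (fun _ => norm_nonneg _) (fun κ => ?_) hsumP
    refine (ContinuousMap.norm_le _ (norm_nonneg _)).2 fun t => ?_
    have h1 : (ω κ : ℂ) * Complex.I * ((t : ℝ) : ℂ)
        = (((ω κ : ℝ) * (t : ℝ) : ℝ) : ℂ) * Complex.I := by
      push_cast
      ring
    simp only [F, ContinuousMap.restrict_apply, ContinuousMap.coe_mk, norm_mul, h1,
      Complex.norm_exp_ofReal_mul_I, one_mul, le_refl]
  have hint : (∫ t in (0 : ℝ)..(2 * Real.pi),
      Complex.exp (-Complex.I * (lam d k : ℂ) * (t : ℂ)) *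
        Pk d n (fun j => Complex.exp (Complex.I * (t : ℂ) * (lam d j : ℂ)) * v j) k)
      = ∫ t in (0 : ℝ)..(2 * Real.pi), ∑' κ, F κ t := by
    congr 1
    funext t
    rw [Pk, ← tsum_mul_left]
    exact tsum_congr fun κ => exp_mul_Pterm_phase d n v k κ t
  rw [hint, ← intervalIntegral.tsum_intervalIntegral_eq_of_summable_norm hF, ← tsum_mul_left, Rk]
  refine tsum_congr fun κ => ?_
  have hpi : (Real.pi : ℂ) ≠ 0 := by exact_mod_cast Real.pi_ne_zero
  simp only [F, ContinuousMap.coe_mk, intervalIntegral.integral_mul_const,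
    integral_exp_int_mul_I, ω, sub_eq_zero]
  unfold Pterm Rterm
  split_ifs <;> first | tauto | (simp; done) | field_simp
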